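/- Let R be a commutative ring and let α_0, …, α_n be a regular sequence on R such that each α_i is a non-zero-divisor of R; let I = (α_0, …, α_n). Fix 0 ≤ k ≤ n and suppose M is an R-module such that for each 0 ≤ j ≤ k, every element of M is annihilated by some power of α_j. Then H_I^i(M) = 0 for all i > n − k. -/

import Mathlib

open CategoryTheory

universe u

open Opposite in
lemma exists_ext_forall_comp_map_eq_zero {R : Type u} [CommRing R] (X Y : ModuleCat.{u} R) (n : ℕ)
    (w : ModuleCat.of R R ⟶ ((Ext R (ModuleCat.{u} R) (n + 1)).obj (op X)).obj Y) :
    ∃ y : Abelian.Ext.{u} X Y (n + 1), ∀ (X' : ModuleCat.{u} R) (f : X' ⟶ X),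
      (Abelian.Ext.mk₀ f).comp y (zero_add _) = 0 →
        w ≫ ((Ext R (ModuleCat.{u} R) (n + 1)).map f.op).app Y = 0 := by
  let F := ((linearYoneda R (ModuleCat.{u} R)).obj Y).rightOp
  let P := projectiveResolution X
  let K := (F.mapHomologicalComplex (ComplexShape.down ℕ)).obj P.complex
  have hR : Injective (op (ModuleCat.of R R)) := inferInstance
  let w₁ : (F.leftDerived (n + 1)).obj X ⟶ op (ModuleCat.of R R) := w.op
  let w₂ : K.homology (n + 1) ⟶ op (ModuleCat.of R R) := (P.isoLeftDerivedObj F (n + 1)).inv ≫ w₁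
  let c : K.opcycles (n + 1) ⟶ op (ModuleCat.of R R) :=
    Injective.factorThru w₂ (K.homologyι (n + 1))
  have hc : K.homologyι (n + 1) ≫ c = w₂ := Injective.comp_factorThru _ _
  let c' : K.X (n + 1) ⟶ op (ModuleCat.of R R) := K.pOpcycles (n + 1) ≫ c
  let z : P.complex.X (n + 1) ⟶ Y := c'.unop.hom (1 : R)
  have hz : P.complex.d (n + 2) (n + 1) ≫ z = 0 := by
    have h : K.d (n + 2) (n + 1) ≫ c' = 0 := by simp [c']
    have := congr($(congrArg Quiver.Hom.unop h).hom (1 : R))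
    exact this
  refine ⟨P.extMk z (n + 2) rfl hz, fun X' f hf ↦ ?_⟩
  let P' := projectiveResolution X'
  let φ : ProjectiveResolution.Hom P' P f :=
    { hom := ProjectiveResolution.lift f P' P
      hom_f_zero_comp_π_f_zero := by
        simpa using ProjectiveResolution.lift_commutes_zero f P' P }
  rw [ProjectiveResolution.mk₀_comp_extMk (φ := φ),
    ProjectiveResolution.extMk_eq_zero_iff _ _ _ _ _ n rfl] at hf
  obtain ⟨g, hg⟩ := hf
  let K' := (F.mapHomologicalComplex (ComplexShape.down ℕ)).obj P'.complex
  let Φ : K' ⟶ K := (F.mapHomologicalComplex (ComplexShape.down ℕ)).map φ.hom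
  let g' : K'.X n ⟶ op (ModuleCat.of R R) :=
    Quiver.Hom.op (ModuleCat.ofHom (LinearMap.toSpanSingleton R (P'.complex.X n ⟶ Y) g))
  have h₁ : K'.d (n + 1) n ≫ g' = Φ.f (n + 1) ≫ c' := by
    apply Quiver.Hom.unop_inj
    apply ModuleCat.hom_ext
    apply LinearMap.ext_ring
    refine Eq.trans ?_ hg
    change P'.complex.d (n + 1) n ≫ ((1 : R) • g) = _
    rw [one_smul]
  have h₂ : K'.fromOpcycles (n + 1) n ≫ g' = HomologicalComplex.opcyclesMap Φ (n + 1) ≫ c := by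
    rw [← cancel_epi (K'.pOpcycles (n + 1))]
    simpa [c'] using h₁
  have h₃ : HomologicalComplex.homologyMap Φ (n + 1) ≫ w₂ = 0 := by
    rw [← hc, HomologicalComplex.homologyι_naturality_assoc, ← h₂]
    simp
  have h₄ : (F.leftDerived (n + 1)).map f ≫ w₁ = 0 := by
    have e : w₁ = (P.isoLeftDerivedObj F (n + 1)).hom ≫ w₂ :=
      (Iso.hom_inv_id_assoc (P.isoLeftDerivedObj F (n + 1)) w₁).symm
    have nat := ProjectiveResolution.isoLeftDerivedObj_hom_naturality f P' P φ.hom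
      φ.hom_f_zero_comp_π_f_zero F (n + 1)
    refine (congrArg (_ ≫ ·) e).trans ((Category.assoc _ _ _).symm.trans
      ((congrArg (· ≫ w₂) nat).trans ?_))
    exact (Category.assoc _ _ _).trans ((congrArg (_ ≫ ·) h₃).trans Limits.comp_zero)
  exact congrArg Quiver.Hom.unop h₄

namespace RingTheory.Sequence

open Function Pointwise

lemma IsWeaklyRegular.of_exact {R : Type*} [CommRing R] {rs : List R} {M₁ M₂ M₃ : Type*}
    [AddCommGroup M₁] [AddCommGroup M₂] [AddCommGroup M₃] [Module R M₁] [Module R M₂] [Module R M₃]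
    {f : M₁ →ₗ[R] M₂} {g : M₂ →ₗ[R] M₃} (hf : Injective f) (hfg : Exact f g) (hg : Surjective g)
    (h₁ : IsWeaklyRegular M₁ rs) (h₃ : IsWeaklyRegular M₃ rs) : IsWeaklyRegular M₂ rs := by
  induction rs generalizing M₁ M₂ M₃ with
  | nil => exact .nil R M₂
  | cons r rs ih =>
    rw [isWeaklyRegular_cons_iff] at h₁ h₃ ⊢
    refine ⟨isSMulRegular_of_range_eq_ker hf hfg.linearMap_ker_eq.symm h₁.1 h₃.1,
      ih ?_ (QuotSMulTop.map_exact r hfg hg) (QuotSMulTop.map_surjective r hg) h₁.2 h₃.2⟩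
    have h := QuotSMulTop.map_first_exact_on_four_term_exact_of_isSMulRegular_last
      (f₁ := (0 : M₁ →ₗ[R] M₁)) (LinearMap.exact_zero_iff_injective M₁ f |>.mpr hf) hfg h₃.1
    rw [map_zero] at h
    exact (LinearMap.exact_zero_iff_injective _ _).mp h

lemma IsWeaklyRegular.of_subsingleton {R : Type*} [CommRing R] (M : Type*) [AddCommGroup M]
    [Module R M] [Subsingleton M] (rs : List R) : IsWeaklyRegular M rs := by
  rw [isWeaklyRegular_iff_Fin]
  exact fun _ ↦ injective_of_subsingleton _

lemma IsWeaklyRegular.quotSMulTop_pow {R : Type*} [CommRing R] {M : Type*} [AddCommGroup M]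
    [Module R M] {r : R} {rs : List R} (hr : IsSMulRegular M r)
    (h : IsWeaklyRegular (QuotSMulTop r M) rs) (t : ℕ) :
    IsWeaklyRegular (QuotSMulTop (r ^ t) M) rs := by
  induction t with
  | zero =>
    have : Subsingleton (QuotSMulTop (r ^ 0) M) := by
      rw [Submodule.Quotient.subsingleton_iff, pow_zero, one_smul]
    exact .of_subsingleton _ _
  | succ t ih =>
    have hle : r ^ (t + 1) • (⊤ : Submodule R M) ≤ r • ⊤ := by
      rintro _ ⟨x, -, rfl⟩
      exact ⟨r ^ t • x, trivial, by simp [smul_smul, pow_succ', mul_comm]⟩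
    have hle' : r ^ t • (⊤ : Submodule R M) ≤
        (r ^ (t + 1) • (⊤ : Submodule R M)).comap (LinearMap.lsmul R M r) := by
      rintro _ ⟨x, -, rfl⟩
      exact ⟨x, trivial, by simp [smul_smul, pow_succ', mul_comm]⟩
    refine .of_exact (f := Submodule.mapQ _ _ (LinearMap.lsmul R M r) hle')
      (g := Submodule.factor hle) ?_ ?_ (Submodule.factor_surjective hle) ih h
    · rw [← LinearMap.ker_eq_bot, LinearMap.ker_eq_bot']
      intro x hx
      obtain ⟨x, rfl⟩ := Submodule.Quotient.mk_surjective _ x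
      rw [Submodule.mapQ_apply, Submodule.Quotient.mk_eq_zero] at hx
      obtain ⟨y, -, hy⟩ := hx
      rw [Submodule.Quotient.mk_eq_zero]
      refine ⟨y, trivial, hr ?_⟩
      simpa [pow_succ', mul_smul] using hy
    · intro x
      obtain ⟨x, rfl⟩ := Submodule.Quotient.mk_surjective _ x
      constructor
      · intro hx
        obtain ⟨y, -, rfl⟩ := (Submodule.Quotient.mk_eq_zero _).mp hx
        exact ⟨Submodule.Quotient.mk y, rfl⟩
      · rintro ⟨y, hy⟩
        obtain ⟨y, rfl⟩ := Submodule.Quotient.mk_surjective _ y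
        rw [← hy]
        exact (Submodule.Quotient.mk_eq_zero _).mpr ⟨y, trivial, rfl⟩

lemma IsWeaklyRegular.map_pow {R : Type*} [CommRing R] {rs : List R} {M : Type*} [AddCommGroup M]
    [Module R M] (h : IsWeaklyRegular M rs) (t : ℕ) :
    IsWeaklyRegular M (rs.map (· ^ t)) := by
  induction rs generalizing M with
  | nil => exact .nil R M
  | cons r rs ih =>
    rw [isWeaklyRegular_cons_iff] at h
    rw [List.map_cons, isWeaklyRegular_cons_iff]
    exact ⟨h.1.pow t, ih (.quotSMulTop_pow h.1 h.2 t)⟩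

end RingTheory.Sequence

section QuotientMaps

variable {R : Type u} [CommRing R]

/-- The canonical projection `R ⧸ I ⟶ R ⧸ J` in `ModuleCat R` for ideals `I ≤ J`. -/
def quotientFactor {I J : Ideal R} (h : I ≤ J) :
    ModuleCat.of R (R ⧸ I) ⟶ ModuleCat.of R (R ⧸ J) :=
  ModuleCat.ofHom (Submodule.factor h)

lemma quotientFactor_comp {I J K : Ideal R} (h : I ≤ J) (h' : J ≤ K) :
    quotientFactor h ≫ quotientFactor h' = quotientFactor (h.trans h') := by
  ext
  rfl

/-- The complex `R ⧸ I ⟶ R ⧸ I ⟶ R ⧸ J` for `J = I ⊔ (s)`, with first map multiplication by `s`. -/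
def quotientMulComplex {I J : Ideal R} (s : R) (hJ : J = I ⊔ Ideal.span {s}) :
    ShortComplex (ModuleCat.{u} R) :=
  .mk (ModuleCat.ofHom (LinearMap.lsmul R (R ⧸ I) s)) (quotientFactor (hJ ▸ le_sup_left)) (by
    refine ModuleCat.hom_ext (LinearMap.ext fun x ↦ ?_)
    obtain ⟨x, rfl⟩ := Submodule.Quotient.mk_surjective _ x
    refine (Submodule.Quotient.mk_eq_zero J).mpr ?_
    rw [hJ]
    exact Ideal.mul_mem_right _ _
      (Ideal.mem_sup_right (Ideal.mem_span_singleton_self s)))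

lemma quotientMulComplex_shortExact {I J : Ideal R} (s : R) (hJ : J = I ⊔ Ideal.span {s})
    (hs : IsSMulRegular (R ⧸ I) s) : (quotientMulComplex s hJ).ShortExact where
  exact := by
    rw [ShortComplex.moduleCat_exact_iff]
    intro x hx
    change R ⧸ I at x
    obtain ⟨x, rfl⟩ := Submodule.Quotient.mk_surjective _ x
    have hx : x ∈ J := (Submodule.Quotient.mk_eq_zero J).mp hx
    rw [hJ, Submodule.mem_sup] at hx
    obtain ⟨y, hy, z, hz, rfl⟩ := hx
    obtain ⟨z, rfl⟩ := Ideal.mem_span_singleton'.mp hz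
    refine ⟨Submodule.Quotient.mk z, (Submodule.Quotient.eq I).mpr ?_⟩
    change s * z - (y + z * s) ∈ I
    rw [mul_comm s z, sub_add_cancel_right]
    exact I.neg_mem hy
  mono_f := (ModuleCat.mono_iff_injective _).mpr hs
  epi_g := (ModuleCat.epi_iff_surjective _).mpr 
    (Submodule.factor_surjective (hJ ▸ le_sup_left))

/-- The morphism of complexes which is the canonical projection on the second and third terms, and
the projection multiplied by `b` on the first, where `s' = s * b`. -/
def quotientMulComplexMap {I I' J J' : Ideal R} {s s' : R} (hJ : J = I ⊔ Ideal.span {s})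
    (hJ' : J' = I' ⊔ Ideal.span {s'}) (hI : I' ≤ I) (hJJ : J' ≤ J) (b : R) (hb : s' = s * b) :
    quotientMulComplex s' hJ' ⟶ quotientMulComplex s hJ where
  τ₁ := quotientFactor hI ≫ ModuleCat.ofHom (LinearMap.lsmul R (R ⧸ I) b)
  τ₂ := quotientFactor hI
  τ₃ := quotientFactor hJJ
  comm₁₂ := by
    refine ModuleCat.hom_ext (LinearMap.ext fun x ↦ ?_)
    change R ⧸ I' at x
    change s • b • Submodule.factor hI x = Submodule.factor hI (s' • x)
    rw [map_smul, hb, mul_smul]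
  comm₂₃ := by
    refine ModuleCat.hom_ext (LinearMap.ext fun x ↦ ?_)
    obtain ⟨x, rfl⟩ := Submodule.Quotient.mk_surjective _ x
    rfl

open Abelian in
lemma exists_ext_forall_quotientFactor_comp_eq_zero {I J : Ideal R} {s : R}
    (hJ : J = I ⊔ Ideal.span {s}) (hIJ : I ≤ J) (hs : IsSMulRegular (R ⧸ I) s)
    {M : ModuleCat.{u} R} {i : ℕ} (x : Ext.{u} (ModuleCat.of R (R ⧸ J)) M (i + 1))
    (hx : (Ext.mk₀ (quotientFactor hIJ)).comp x (zero_add _) = 0) :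
    ∃ y : Ext.{u} (ModuleCat.of R (R ⧸ I)) M i, ∀ {I' J' : Ideal R} {s' b : R}
      (_ : J' = I' ⊔ Ideal.span {s'}) (hI : I' ≤ I) (hJJ : J' ≤ J) (_ : s' = s * b)
      (_ : IsSMulRegular (R ⧸ I') s'),
      (Ext.mk₀ (quotientFactor hI)).comp
        ((Ext.mk₀ (ModuleCat.ofHom (LinearMap.lsmul R (R ⧸ I) b))).comp y (zero_add i))
          (zero_add i) = 0 →
      (Ext.mk₀ (quotientFactor hJJ)).comp x (zero_add _) = 0 := by
  have hS := quotientMulComplex_shortExact s hJ hs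
  obtain ⟨y, hy⟩ := Ext.contravariant_sequence_exact₃ hS M x hx (add_comm 1 i)
  refine ⟨y, fun {I' J' s' b} hJ' hI hJJ hb hs' h ↦ ?_⟩
  have hS' := quotientMulComplex_shortExact s' hJ' hs'
  let φ := quotientMulComplexMap hJ hJ' hI hJJ b hb
  have h' : (Ext.mk₀ φ.τ₁).comp y (zero_add i) = 0 := by
    exact (Ext.mk₀_comp_mk₀_assoc _ _ _).symm.trans h
  change (Ext.mk₀ φ.τ₃).comp x (zero_add _) = 0
  rw [← hy, ← Ext.comp_assoc _ _ _ (zero_add 1) (add_comm 1 i) (by lia),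
    ← ShortComplex.ShortExact.extClass_naturality hS' hS,
    Ext.comp_assoc _ _ _ (add_zero 1) (zero_add i) (by lia), h', Ext.comp_zero]

end QuotientMaps

namespace RingTheory.Sequence

variable {R : Type u} [CommRing R]

lemma ofList_map_pow_le (rs : List R) {t t' : ℕ} (h : t ≤ t') :
    Ideal.ofList (rs.map (· ^ t')) ≤ Ideal.ofList (rs.map (· ^ t)) := by
  refine Ideal.span_le.mpr fun x hx ↦ ?_
  obtain ⟨r, hr, rfl⟩ := List.mem_map.mp hx
  exact Ideal.pow_mem_of_pow_mem _ (Ideal.subset_span (List.mem_map.mpr ⟨r, hr, rfl⟩)) h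

lemma ofList_map_pow_append_singleton (rs : List R) (r : R) (t : ℕ) :
    Ideal.ofList ((rs ++ [r]).map (· ^ t)) =
      Ideal.ofList (rs.map (· ^ t)) ⊔ Ideal.span {r ^ t} := by
  rw [List.map_append, Ideal.ofList_append, List.map_singleton, Ideal.ofList_singleton]

open Abelian in
/-- If `rs` is weakly regular and the module `M` is power torsion for the first `k` elements of
`rs`, then the ind-system `Ext i (R ⧸ (r ^ t | r ∈ rs)) M` vanishes for `i > rs.length - k`. -/
lemma IsWeaklyRegular.exists_quotientFactor_comp_ext_eq_zero {rs : List R}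
    (hrs : IsWeaklyRegular R rs) (M : ModuleCat.{u} R) (k : ℕ)
    (hM : ∀ r ∈ rs.take k, ∀ m : M, ∃ t : ℕ, r ^ t • m = 0) (i : ℕ) (hi : rs.length - k < i)
    (t : ℕ) (x : Ext.{u} (ModuleCat.of R (R ⧸ Ideal.ofList (rs.map (· ^ t)))) M i) :
    ∃ (t' : ℕ) (h : t ≤ t'),
      (Ext.mk₀ (quotientFactor (ofList_map_pow_le rs h))).comp x (zero_add i) = 0 := by
  induction rs using List.reverseRecOn generalizing i t with
  | nil =>
    have : Projective (ModuleCat.of R (R ⧸ Ideal.ofList (([] : List R).map (· ^ t)))) := by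
      have e : R ≃ₗ[R] R ⧸ Ideal.ofList (([] : List R).map (· ^ t)) :=
        (Submodule.quotEquivOfEqBot _ (by simp)).symm
      have : Module.Projective R (R ⧸ Ideal.ofList (([] : List R).map (· ^ t))) := .of_equiv e
      exact ModuleCat.projective_of_categoryTheory_projective _
    obtain ⟨i, rfl⟩ := Nat.exists_eq_succ_of_ne_zero (by lia : i ≠ 0)
    exact ⟨t, le_rfl, by rw [Ext.eq_zero_of_projective x, Ext.comp_zero]⟩
  | append_singleton rs r ih =>
    have hrs' := ((isWeaklyRegular_append_iff R rs [r]).mp hrs).1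
    have hM' : ∀ r ∈ rs.take k, ∀ m : M, ∃ t : ℕ, r ^ t • m = 0 := fun s hs ↦
      hM s (by rw [List.take_append]; exact List.mem_append_left _ hs)
    rw [List.length_append, List.length_singleton] at hi
    have hreg (t : ℕ) : IsSMulRegular (R ⧸ Ideal.ofList (rs.map (· ^ t))) (r ^ t) := by
      have := (isWeaklyRegular_append_iff R (rs.map (· ^ t)) [r ^ t]).mp
        (by simpa using hrs.map_pow t)
      rw [isWeaklyRegular_singleton_iff] at this
      have h : (Ideal.ofList (rs.map (· ^ t)) • ⊤ : Ideal R) = Ideal.ofList (rs.map (· ^ t)) :=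
        Ideal.mul_top _
      exact h ▸ this.2
    let hJ := ofList_map_pow_append_singleton rs r
    have hle (t : ℕ) : Ideal.ofList (rs.map (· ^ t)) ≤ Ideal.ofList ((rs ++ [r]).map (· ^ t)) :=
      le_sup_left.trans (hJ t).ge
    obtain ⟨i, rfl⟩ := Nat.exists_eq_succ_of_ne_zero (by lia : i ≠ 0)
    obtain ⟨t₁, h₁, hx⟩ := ih hrs' hM' (i + 1) (by lia) t
      ((Ext.mk₀ (quotientFactor (hle t))).comp x (zero_add _))
    rw [Ext.mk₀_comp_mk₀_assoc, quotientFactor_comp, ← quotientFactor_comp (hle t₁)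
      (ofList_map_pow_le (rs ++ [r]) h₁), ← Ext.mk₀_comp_mk₀_assoc] at hx
    obtain ⟨y, hy⟩ := exists_ext_forall_quotientFactor_comp_eq_zero (hJ t₁) (hle t₁) (hreg t₁) _ hx
    suffices h : ∃ (t₂ : ℕ) (h₂ : t₁ ≤ t₂),
        (Ext.mk₀ (quotientFactor (ofList_map_pow_le rs h₂))).comp
          ((Ext.mk₀ (ModuleCat.ofHom (LinearMap.lsmul R (R ⧸ Ideal.ofList (rs.map (· ^ t₁)))
            (r ^ (t₂ - t₁))))).comp y (zero_add i)) (zero_add i) = 0 by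
      obtain ⟨t₂, h₂, h⟩ := h
      refine ⟨t₂, h₁.trans h₂, ?_⟩
      rw [← quotientFactor_comp (ofList_map_pow_le (rs ++ [r]) h₂)
        (ofList_map_pow_le (rs ++ [r]) h₁), ← Ext.mk₀_comp_mk₀_assoc]
      exact hy (hJ t₂) _ _ (by rw [← pow_add, Nat.add_sub_cancel' h₂]) (hreg t₂) h
    by_cases hi' : rs.length - k < i
    · obtain ⟨t₂, h₂, h⟩ := ih hrs' hM' i hi' t₁ y
      refine ⟨t₂, h₂, ?_⟩
      have comm : quotientFactor (ofList_map_pow_le rs h₂) ≫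
          ModuleCat.ofHom (LinearMap.lsmul R (R ⧸ Ideal.ofList (rs.map (· ^ t₁)))
            (r ^ (t₂ - t₁))) =
          ModuleCat.ofHom (LinearMap.lsmul R (R ⧸ Ideal.ofList (rs.map (· ^ t₂)))
            (r ^ (t₂ - t₁))) ≫ quotientFactor (ofList_map_pow_le rs h₂) :=
        ModuleCat.hom_ext (LinearMap.ext fun x ↦
          (map_smul (Submodule.factor (ofList_map_pow_le rs h₂)) (r ^ (t₂ - t₁))
            (show R ⧸ Ideal.ofList (rs.map (· ^ t₂)) from x)).symm)
      rw [Ext.mk₀_comp_mk₀_assoc, comm, ← Ext.mk₀_comp_mk₀_assoc, h, Ext.comp_zero]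
    · obtain rfl : i = 0 := by lia
      obtain ⟨f, rfl⟩ := Ext.mk₀_bijective _ _ |>.surjective y
      obtain ⟨s, hs⟩ := hM r (by
        rw [List.take_of_length_le (by rw [List.length_append, List.length_singleton]; lia)]
        simp) (f.hom (Submodule.Quotient.mk 1))
      refine ⟨t₁ + s, Nat.le_add_right _ _, ?_⟩
      have hf : ModuleCat.ofHom (LinearMap.lsmul R (R ⧸ Ideal.ofList (rs.map (· ^ t₁)))
          (r ^ (t₁ + s - t₁))) ≫ f = 0 := by
        rw [Nat.add_sub_cancel_left]
        refine ModuleCat.hom_ext (Submodule.linearMap_qext _ (LinearMap.ext_ring ?_))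
        exact (map_smul f.hom _ _).trans hs
      rw [Ext.mk₀_comp_mk₀, hf, Ext.mk₀_zero, Ext.comp_zero]

end RingTheory.Sequence

lemma localCohomology.subsingleton_obj_of_exists_comp_map_eq_zero {R : Type u} [CommRing R]
    (I : Ideal R) (i : ℕ) (M : ModuleCat.{u} R)
    (h : ∀ (j : ℕ) (w : ModuleCat.of R R ⟶
        ((Ext R (ModuleCat.{u} R) i).obj (.op (ModuleCat.of R (R ⧸ I ^ j)))).obj M),
      ∃ (j' : ℕ) (hj : j ≤ j'), w ≫ ((Ext R (ModuleCat.{u} R) i).map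
        (quotientFactor (Ideal.pow_le_pow_right hj)).op).app M = 0) :
    Subsingleton ((localCohomology I i).obj M) := by
  have := localCohomology.hasColimitDiagram.{u, 0} (localCohomology.idealPowersDiagram I) i
  let D := localCohomology.diagram (localCohomology.idealPowersDiagram I) i
  let E := (evaluation (ModuleCat.{u} R) (ModuleCat.{u} R)).obj M
  have hc : Limits.IsColimit (E.mapCocone (Limits.colimit.cocone D)) :=
    Limits.isColimitOfPreserves E (Limits.colimit.isColimit D)
  have hz : 𝟙 ((localCohomology I i).obj M) = 0 := by
    refine hc.hom_ext fun j ↦ ?_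
    refine (Category.comp_id _).trans (Eq.trans ?_ Limits.comp_zero.symm)
    refine ModuleCat.hom_ext (LinearMap.ext fun x ↦ ?_)
    obtain ⟨j', hj, hw⟩ := h j.unop.unop (ModuleCat.ofHom (LinearMap.toSpanSingleton R _ x))
    let f : j ⟶ .op (.op j') := (homOfLE hj).op.op
    have hx : ((D.map f).app M).hom x = 0 := by
      refine Eq.trans (congrArg _ (one_smul R x).symm) ?_
      exact congr($(hw).hom (1 : R))
    have hn := congr($((E.mapCocone (Limits.colimit.cocone D)).w f).hom x)
    refine hn.symm.trans ?_
    exact (congrArg _ hx).trans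
      (((E.mapCocone (Limits.colimit.cocone D)).ι.app (.op (.op j'))).hom.map_zero)
  exact ModuleCat.subsingleton_of_isZero ((Limits.IsZero.iff_id_eq_zero _).mpr hz)

theorem stmt15 {R : Type u} [CommRing R] (n : ℕ) (α : Fin (n + 1) → R)
    (hreg : RingTheory.Sequence.IsWeaklyRegular R (List.ofFn α))
    (hnzd : ∀ i, α i ∈ nonZeroDivisors R)
    (k : ℕ) (hk : k ≤ n)
    (M : Type u) [AddCommGroup M] [Module R M]
    (htors : ∀ j : Fin (n + 1), (j : ℕ) ≤ k → ∀ m : M, ∃ t : ℕ, α j ^ t • m = 0)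
    (i : ℕ) (hi : n - k < i) :
    Subsingleton ((localCohomology (Ideal.span (Set.range α)) i).obj (ModuleCat.of R M)) := by
  have hspan : Ideal.ofList (List.ofFn α) = Ideal.span (Set.range α) :=
    congrArg Ideal.span (Set.ext fun r ↦ List.mem_ofFn)
  obtain ⟨i, rfl⟩ := Nat.exists_eq_succ_of_ne_zero (by lia : i ≠ 0)
  refine localCohomology.subsingleton_obj_of_exists_comp_map_eq_zero _ _ _ fun j w ↦ ?_
  obtain ⟨y, hy⟩ := exists_ext_forall_comp_map_eq_zero _ _ _ w
  have hle : Ideal.ofList ((List.ofFn α).map (· ^ j)) ≤ Ideal.span (Set.range α) ^ j := by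
    refine Ideal.span_le.mpr fun x hx ↦ ?_
    obtain ⟨r, hr, rfl⟩ := List.mem_map.mp hx
    exact Ideal.pow_mem_pow (hspan ▸ Ideal.subset_span hr) j
  obtain ⟨t, ht, h⟩ := hreg.exists_quotientFactor_comp_ext_eq_zero (ModuleCat.of R M) (k + 1)
    (fun r hr m ↦ by
      obtain ⟨l, hl, rfl⟩ := List.mem_take_iff_getElem.mp hr
      rw [List.length_ofFn] at hl
      rw [List.getElem_ofFn]
      exact htors ⟨l, by lia⟩ (show l ≤ k by lia) m)
    (i + 1) (by rw [List.length_ofFn]; lia) j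
    ((Abelian.Ext.mk₀ (quotientFactor hle)).comp y (zero_add _))
  obtain ⟨N, hN⟩ : ∃ N, Ideal.span (Set.range α) ^ N ≤
      Ideal.ofList ((List.ofFn α).map (· ^ t)) := by
    refine Ideal.exists_pow_le_of_le_radical_of_fg ?_ (Submodule.fg_span (Set.finite_range α))
    rw [← hspan]
    exact Ideal.span_le.mpr fun r hr ↦ ⟨t, Ideal.subset_span (List.mem_map.mpr ⟨r, hr, rfl⟩)⟩
  have hN' := (Ideal.pow_le_pow_right (le_max_right j N)).trans hN
  refine ⟨max j N, le_max_left _ _, hy _ _ ?_⟩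
  rw [← quotientFactor_comp (hN'.trans (RingTheory.Sequence.ofList_map_pow_le _ ht)) hle,
    ← quotientFactor_comp hN' (RingTheory.Sequence.ofList_map_pow_le _ ht), Category.assoc,
    ← Abelian.Ext.mk₀_comp_mk₀_assoc, ← Abelian.Ext.mk₀_comp_mk₀_assoc, h, Abelian.Ext.comp_zero]
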